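/- arXiv:1905.00457 — 2 statements merged into one kernel-verified Lean document; each statement's English description precedes it below -/
import Mathlib

section
/- Let m = 2 and let A^U be the uniform phantom mechanism, defined by A^U(P)_1 = med(p̂_{1,1}, …, p̂_{n,1}, 1, (n−1)/n, …, 1/n, 0) and A^U(P)_2 = 1 − A^U(P)_1. Then A^U is anonymous, continuous, incentive compatible, and proportional; moreover, every anonymous and continuous budget aggregation mechanism for m = 2 that is incentive compatible and proportional coincides with A^U on all preference profiles. -/
open Finset

/-- `p` is a budget division over `m` alternatives: entries in `[0,1]` summing to `1`. -/
def IsDivision {m : ℕ} (p : Fin m → ℝ) : Prop :=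
  (∀ j, p j ∈ Set.Icc (0 : ℝ) 1) ∧ ∑ j, p j = 1

/-- A valid preference profile: every voter reports a budget division. -/
def IsProfile {n m : ℕ} (P : Fin n → Fin m → ℝ) : Prop :=
  ∀ i, IsDivision (P i)

/-- The ℓ1 distance between two vectors. -/
noncomputable def l1 {m : ℕ} (x y : Fin m → ℝ) : ℝ := ∑ j, |x j - y j|

/-- Median of a list of odd length `2k+1`: its `(k+1)`-st smallest element. -/
noncomputable def medList (l : List ℝ) : ℝ :=
  ((Multiset.ofList l).sort (· ≤ ·)).getD ((l.length - 1) / 2) 0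

/-- Coordinate-wise generalized median on alternative `j`, with phantoms `f k t` and
the voters' reports on alternative `j`. -/
noncomputable def phMed {n m : ℕ} (f : Fin (n + 1) → ℝ → ℝ)
    (P : Fin n → Fin m → ℝ) (t : ℝ) (j : Fin m) : ℝ :=
  medList (List.ofFn (fun k => f k t) ++ List.ofFn (fun i => P i j))

/-- A phantom system for `n` voters: `n+1` continuous, weakly increasing functions
`[0,1] → [0,1]` with `f k 0 = 0`, `f k 1 = 1`, ordered `f 0 ≥ f 1 ≥ ⋯ ≥ f n`. -/
structure IsPhantomSystem (n : ℕ) (f : Fin (n + 1) → ℝ → ℝ) : Prop where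
  cont : ∀ k, ContinuousOn (f k) (Set.Icc 0 1)
  mono : ∀ k, MonotoneOn (f k) (Set.Icc 0 1)
  mem_Icc : ∀ k, ∀ t ∈ Set.Icc (0 : ℝ) 1, f k t ∈ Set.Icc (0 : ℝ) 1
  apply_zero : ∀ k, f k 0 = 0
  apply_one : ∀ k, f k 1 = 1
  ordered : ∀ t ∈ Set.Icc (0 : ℝ) 1, ∀ k l : Fin (n + 1), k ≤ l → f l t ≤ f k t

/-- The normalizing time `t*` at which the coordinate-wise medians sum to `1`. -/
noncomputable def tStar {n m : ℕ} (f : Fin (n + 1) → ℝ → ℝ)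
    (P : Fin n → Fin m → ℝ) : ℝ :=
  sInf {t | t ∈ Set.Icc (0 : ℝ) 1 ∧ ∑ j, phMed f P t j = 1}

/-- The moving phantom mechanism `A^F` defined by the phantom family `f`. -/
noncomputable def AMP {n m : ℕ} (f : Fin (n + 1) → ℝ → ℝ)
    (P : Fin n → Fin m → ℝ) : Fin m → ℝ :=
  fun j => phMed f P (tStar f P) j

/-- The independent-markets phantom system for `n` voters: `f k t = min (t(n-k)) 1`. -/
noncomputable def fIM (n : ℕ) : Fin (n + 1) → ℝ → ℝ :=
  fun k t => min (t * ((n : ℝ) - (k : ℝ))) 1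

/-- The phantom system `F*` for `n` voters, in which the phantoms move to 1 one at a time. -/
noncomputable def fStar (n : ℕ) : Fin (n + 1) → ℝ → ℝ :=
  fun k t => max 0 (min 1 (t * ((n : ℝ) + 1) - (k : ℝ)))

/-- The `j`-th standard unit vector in `ℝ^m`. -/
def unitVec (m : ℕ) (j : Fin m) : Fin m → ℝ := fun k => if k = j then 1 else 0

/-- Incentive compatibility under ℓ1 preferences. -/
def IncentiveCompatible {n m : ℕ} (A : (Fin n → Fin m → ℝ) → (Fin m → ℝ)) : Prop :=
  ∀ P : Fin n → Fin m → ℝ, IsProfile P → ∀ i : Fin n,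
    ∀ ptrue pmis : Fin m → ℝ, IsDivision ptrue → IsDivision pmis →
      l1 (A (Function.update P i ptrue)) ptrue ≤ l1 (A (Function.update P i pmis)) ptrue

/-- Anonymity: the output is invariant under permutations of the voters. -/
def Anonymous {n m : ℕ} (A : (Fin n → Fin m → ℝ) → (Fin m → ℝ)) : Prop :=
  ∀ P : Fin n → Fin m → ℝ, IsProfile P → ∀ σ : Equiv.Perm (Fin n), A (P ∘ σ) = A P

/-- Neutrality: permuting the alternatives in all reports permutes the output likewise. -/
def Neutral {n m : ℕ} (A : (Fin n → Fin m → ℝ) → (Fin m → ℝ)) : Prop :=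
  ∀ P : Fin n → Fin m → ℝ, IsProfile P → ∀ σ : Equiv.Perm (Fin m),
    A (fun i j => P i (σ j)) = fun j => A P (σ j)

/-- Proportionality: on single-minded profiles, alternative `j` gets `n_j / n`. -/
def Proportional {n m : ℕ} (A : (Fin n → Fin m → ℝ) → (Fin m → ℝ)) : Prop :=
  ∀ P : Fin n → Fin m → ℝ, (∀ i, ∃ j, P i = unitVec m j) →
    ∀ j, A P j = (Nat.card {i : Fin n // P i = unitVec m j} : ℝ) / (n : ℝ)

/-- Pareto optimality. -/
def ParetoOptimal {n m : ℕ} (A : (Fin n → Fin m → ℝ) → (Fin m → ℝ)) : Prop :=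
  ∀ P : Fin n → Fin m → ℝ, IsProfile P → ∀ q : Fin m → ℝ, IsDivision q →
    (∃ i, l1 q (P i) < l1 (A P) (P i)) → ∃ i, l1 (A P) (P i) < l1 q (P i)

/-- A mechanism is valid if it maps profiles to budget divisions. -/
def ValidMech {n m : ℕ} (A : (Fin n → Fin m → ℝ) → (Fin m → ℝ)) : Prop :=
  ∀ P, IsProfile P → IsDivision (A P)

/-- `q` maximizes (utilitarian) social welfare for `P`, i.e. minimizes total ℓ1 distance. -/
def MaximizesWelfare {n m : ℕ} (P : Fin n → Fin m → ℝ) (q : Fin m → ℝ) : Prop :=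
  IsDivision q ∧ ∀ q' : Fin m → ℝ, IsDivision q' → ∑ i, l1 (P i) q ≤ ∑ i, l1 (P i) q'

/-- The `k`-th largest entry of `v` (1-indexed); `0` when `k > n`. -/
noncomputable def kthLargest {n : ℕ} (v : Fin n → ℝ) (k : ℕ) : ℝ :=
  (((Multiset.ofList (List.ofFn v)).sort (· ≤ ·)).reverse).getD (k - 1) 0

/-- The uniform phantom mechanism for `m = 2`: the first coordinate is the median of the
reports on alternative 1 together with the phantoms `1, (n-1)/n, …, 1/n, 0`, and the
second coordinate is one minus the first. -/
noncomputable def AUnif (n : ℕ) : (Fin n → Fin 2 → ℝ) → Fin 2 → ℝ :=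
  fun P j =>
    if j = 0 then
      medList (List.ofFn (fun k : Fin (n + 1) => ((n : ℝ) - (k : ℝ)) / (n : ℝ)) ++
        List.ofFn (fun i => P i 0))
    else
      1 - medList (List.ofFn (fun k : Fin (n + 1) => ((n : ℝ) - (k : ℝ)) / (n : ℝ)) ++
        List.ofFn (fun i => P i 0))

theorem sorted_le_getD (s : List ℝ) (hs : s.Pairwise (· ≤ ·)) (x : ℝ) :
    ∀ k, k < s.length → (x ≤ s.getD k 0 ↔ s.length ≤ s.countP (fun a => decide (x ≤ a)) + k) := by
  induction s with
  | nil => intro k hk; simp at hk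
  | cons a t ih =>
    intro k hk
    rw [List.pairwise_cons] at hs
    have hall : x ≤ a → t.countP (fun a => decide (x ≤ a)) = t.length := by
      intro h
      rw [List.countP_eq_length]
      intro b hb
      simpa using h.trans (hs.1 b hb)
    have hle := List.countP_le_length (p := fun a => decide (x ≤ a)) (l := t)
    by_cases hxa : x ≤ a
    · have hc := hall hxa
      cases k with
      | zero => simp [hxa, hc]
      | succ k =>
        have hk' : k < t.length := by simpa using hk
        have : x ≤ t.getD k 0 := by
          rw [List.getD_eq_getElem _ _ hk']
          exact hxa.trans (hs.1 _ (List.getElem_mem hk'))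
        simp only [List.getD_cons_succ, this, List.length_cons, true_iff]
        rw [List.countP_cons_of_pos (by simpa using hxa)]
        omega
    · cases k with
      | zero =>
        simp only [List.getD_cons_zero, hxa, false_iff, List.length_cons]
        rw [List.countP_cons_of_neg (by simpa using hxa)]
        omega
      | succ k =>
        have hk' : k < t.length := by simpa using hk
        have := ih hs.2 k hk'
        simp only [List.getD_cons_succ, List.length_cons]
        rw [List.countP_cons_of_neg (by simpa using hxa), this]
        omega

theorem countP_ofFn_eq {n : ℕ} (f : Fin n → ℝ) (x : ℝ) :
    (List.ofFn f).countP (fun a => decide (x ≤ a)) = (univ.filter (fun i => x ≤ f i)).card := by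
  induction n with
  | zero => simp
  | succ n ih =>
    rw [List.ofFn_succ, Fin.univ_succ, List.countP_cons, ih, Finset.filter_cons]
    by_cases h : x ≤ f 0
    · simp [h, Finset.filter_map, Function.comp_def]
    · simp [h, Finset.filter_map, Function.comp_def]

/-- The median with uniform phantoms. -/
noncomputable def MU (n : ℕ) (v : Fin n → ℝ) : ℝ :=
  medList (List.ofFn (fun k : Fin (n + 1) => ((n : ℝ) - (k : ℝ)) / (n : ℝ)) ++ List.ofFn v)

theorem le_MU {n : ℕ} (hn : 1 ≤ n) (v : Fin n → ℝ) (x : ℝ) :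
    x ≤ MU n v ↔ (n : ℝ) * x ≤ ((univ.filter (fun i => x ≤ v i)).card : ℝ) := by
  have hn0 : (0 : ℝ) < n := by exact_mod_cast hn
  unfold MU medList
  set l := List.ofFn (fun k : Fin (n + 1) => ((n : ℝ) - (k : ℝ)) / (n : ℝ)) ++ List.ofFn v with hl
  have hlen : l.length = 2 * n + 1 := by simp [hl]; ring
  have hperm : ((Multiset.ofList l).sort (· ≤ ·)).Perm l := by
    rw [← Multiset.coe_eq_coe, Multiset.sort_eq]
  rw [sorted_le_getD _ (Multiset.pairwise_sort _ _) x _ (by rw [hperm.length_eq, hlen]; omega),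
    hperm.length_eq, hperm.countP_eq, hlen]
  rw [hl, List.countP_append, countP_ofFn_eq, countP_ofFn_eq]
  set c := (univ.filter (fun i => x ≤ v i)).card with hc
  have hcn : c ≤ n := by
    have := Finset.card_filter_le (univ : Finset (Fin n)) (fun i => x ≤ v i)
    simpa using this
  have e : ∀ k : Fin (n + 1), x ≤ ((n : ℝ) - (k : ℝ)) / (n : ℝ) ↔ (n : ℝ) * x ≤ n - (k : ℕ) := by
    intro k; rw [le_div_iff₀ hn0, mul_comm]
  simp only [e]
  constructor
  · intro h
    by_contra hlt
    push Not at hlt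
    have hsub : (univ.filter (fun k : Fin (n + 1) => (n : ℝ) * x ≤ n - (k : ℕ))) ⊆
        Finset.Iio (⟨n - c, by omega⟩ : Fin (n + 1)) := by
      intro k hk
      simp only [Finset.mem_filter, Finset.mem_univ, true_and] at hk
      rw [Finset.mem_Iio, Fin.lt_def]
      have h1 : (c : ℝ) + (k : ℕ) < n := by linarith
      have h2 : c + (k : ℕ) < n := by exact_mod_cast h1
      simp only
      omega
    have := Finset.card_le_card hsub
    rw [Fin.card_Iio] at this
    simp only at this
    omega
  · intro h
    have hsub : Finset.Iic (⟨n - c, by omega⟩ : Fin (n + 1)) ⊆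
        (univ.filter (fun k : Fin (n + 1) => (n : ℝ) * x ≤ n - (k : ℕ))) := by
      intro k hk
      rw [Finset.mem_Iic, Fin.le_def] at hk
      simp only [Finset.mem_filter, Finset.mem_univ, true_and]
      simp only at hk
      have h2 : c + (k : ℕ) ≤ n := by omega
      have h1 : (c : ℝ) + (k : ℕ) ≤ n := by exact_mod_cast h2
      linarith
    have := Finset.card_le_card hsub
    rw [Fin.card_Iic] at this
    simp only at this
    omega

theorem MU_eq {n : ℕ} (hn : 1 ≤ n) (v : Fin n → ℝ) (y : ℝ)
    (h1 : (n : ℝ) * y ≤ ((univ.filter (fun i => y ≤ v i)).card : ℝ))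
    (h2 : ((univ.filter (fun i => y < v i)).card : ℝ) ≤ (n : ℝ) * y) : MU n v = y := by
  have hn0 : (0 : ℝ) < n := by exact_mod_cast hn
  refine le_antisymm ?_ ((le_MU hn v y).2 h1)
  by_contra hlt
  push Not at hlt
  have h3 := (le_MU hn v _).1 (le_refl (MU n v))
  have h4 : (univ.filter (fun i => MU n v ≤ v i)).card ≤ (univ.filter (fun i => y < v i)).card := by
    apply Finset.card_le_card
    intro i hi
    simp only [Finset.mem_filter, Finset.mem_univ, true_and] at hi ⊢
    linarith
  have h5 : ((univ.filter (fun i => MU n v ≤ v i)).card : ℝ) ≤ (univ.filter (fun i => y < v i)).card := by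
    exact_mod_cast h4
  nlinarith

theorem MU_mono_of {n : ℕ} (hn : 1 ≤ n) (v w : Fin n → ℝ) (x x' : ℝ) (hx : x ≤ MU n v)
    (hx' : x' ≤ x) (h : ∀ i, x ≤ v i → x' ≤ w i) : x' ≤ MU n w := by
  have hn0 : (0 : ℝ) < n := by exact_mod_cast hn
  rw [le_MU hn] at hx ⊢
  have h4 : (univ.filter (fun i => x ≤ v i)).card ≤ (univ.filter (fun i => x' ≤ w i)).card := by
    apply Finset.card_le_card
    intro i hi
    simp only [Finset.mem_filter, Finset.mem_univ, true_and] at hi ⊢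
    exact h i hi
  have h5 : ((univ.filter (fun i => x ≤ v i)).card : ℝ) ≤ (univ.filter (fun i => x' ≤ w i)).card := by
    exact_mod_cast h4
  nlinarith

theorem MU_lip {n : ℕ} (hn : 1 ≤ n) : LipschitzWith 1 (MU n) := by
  apply LipschitzWith.of_le_add
  intro v w
  have : MU n v - dist v w ≤ MU n w := by
    apply MU_mono_of hn v w _ _ le_rfl (by linarith [dist_nonneg (x := v) (y := w)])
    intro i hi
    have := dist_le_pi_dist v w i
    rw [Real.dist_eq, abs_le] at this
    linarith [this.2]
  linarith

theorem MU_perm {n : ℕ} (hn : 1 ≤ n) (v : Fin n → ℝ) (σ : Equiv.Perm (Fin n)) :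
    MU n (v ∘ σ) = MU n v := by
  apply eq_of_forall_le_iff
  intro x
  rw [le_MU hn, le_MU hn]
  have : (univ.filter (fun i => x ≤ (v ∘ σ) i)).card = (univ.filter (fun i => x ≤ v i)).card := by
    apply Finset.card_equiv σ
    intro i
    simp
  rw [this]

theorem MU_ic {n : ℕ} (hn : 1 ≤ n) (v : Fin n → ℝ) (i : Fin n) (t s : ℝ) :
    |MU n (Function.update v i t) - t| ≤ |MU n (Function.update v i s) - t| := by
  set y := MU n (Function.update v i t) with hy
  set z := MU n (Function.update v i s) with hz
  rcases lt_trichotomy y t with h | h | h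
  · have hzy : z ≤ y := by
      by_contra hlt
      push Not at hlt
      have : min z t ≤ y := by
        apply MU_mono_of hn (Function.update v i s) _ z _ le_rfl (min_le_left _ _)
        intro j hj
        by_cases hji : j = i
        · subst hji; simp
        · simp only [Function.update_of_ne hji] at hj ⊢
          exact (min_le_left _ _).trans hj
      exact absurd this (not_le.2 (lt_min hlt h))
    rw [abs_of_neg (by linarith), abs_of_neg (by linarith)]; linarith
  · rw [h]; simp
  · have hzy : y ≤ z := by
      apply MU_mono_of hn (Function.update v i t) _ y _ le_rfl le_rfl
      intro j hj
      by_cases hji : j = i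
      · subst hji; simp at hj; linarith
      · simp only [Function.update_of_ne hji] at hj ⊢
        exact hj
    rw [abs_of_pos (by linarith), abs_of_pos (by linarith)]; linarith

theorem AUnif_zero {n : ℕ} (P : Fin n → Fin 2 → ℝ) : AUnif n P 0 = MU n (fun i => P i 0) := by
  simp [AUnif, MU]

theorem AUnif_one {n : ℕ} (P : Fin n → Fin 2 → ℝ) : AUnif n P 1 = 1 - MU n (fun i => P i 0) := by
  simp [AUnif, MU]

theorem division_snd {p : Fin 2 → ℝ} (h : IsDivision p) : p 1 = 1 - p 0 := by
  have := h.2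
  rw [Fin.sum_univ_two] at this
  linarith

theorem l1_two (x y : Fin 2 → ℝ) (hx : x 1 = 1 - x 0) (hy : y 1 = 1 - y 0) :
    l1 x y = 2 * |x 0 - y 0| := by
  unfold l1
  rw [Fin.sum_univ_two, hx, hy]
  have : (1 - x 0 - (1 - y 0)) = -(x 0 - y 0) := by ring
  rw [this, abs_neg]; ring

/-- The division with first entry `x`. -/
def mkDiv (x : ℝ) : Fin 2 → ℝ := ![x, 1 - x]

theorem mkDiv_isDiv {x : ℝ} (h : x ∈ Set.Icc (0 : ℝ) 1) : IsDivision (mkDiv x) := by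
  constructor
  · intro j
    fin_cases j
    · simpa [mkDiv] using h
    · simp [mkDiv]; exact ⟨h.2, h.1⟩
  · simp [mkDiv]

theorem mkDiv_eq {p : Fin 2 → ℝ} (h : IsDivision p) : mkDiv (p 0) = p := by
  ext j
  fin_cases j
  · simp [mkDiv]
  · simp [mkDiv, division_snd h]

theorem unit_cases (p : Fin 2 → ℝ) (h : ∃ j, p = unitVec 2 j) : p = mkDiv 1 ∨ p = mkDiv 0 := by
  obtain ⟨j, rfl⟩ := h
  fin_cases j
  · left; ext k; fin_cases k <;> simp [unitVec, mkDiv]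
  · right; ext k; fin_cases k <;> simp [unitVec, mkDiv]

theorem unit_zero : unitVec 2 0 = mkDiv 1 := by
  ext k; fin_cases k <;> simp [unitVec, mkDiv]

theorem unit_one : unitVec 2 1 = mkDiv 0 := by
  ext k; fin_cases k <;> simp [unitVec, mkDiv]

theorem AUnif_prop {n : ℕ} (hn : 1 ≤ n) : Proportional (AUnif n) := by
  intro P hP
  have hn0 : (0 : ℝ) < n := by exact_mod_cast hn
  have hc : ∀ i, P i = mkDiv 1 ∨ P i = mkDiv 0 := fun i => unit_cases _ (hP i)
  have h01 : mkDiv 1 ≠ mkDiv 0 := by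
    intro h; have := congrFun h 0; simp [mkDiv] at this
  have hcard : (univ.filter (fun i => P i = mkDiv 1)).card
      + (univ.filter (fun i => P i = mkDiv 0)).card = n := by
    have h := Finset.card_filter_add_card_filter_not (s := (univ : Finset (Fin n)))
      (fun i => P i = mkDiv 1)
    rw [Finset.card_univ, Fintype.card_fin] at h
    refine Eq.trans ?_ h
    congr 2
    ext i
    simp only [Finset.mem_filter, Finset.mem_univ, true_and]
    rcases hc i with h | h <;> simp [h, h01, h01.symm]
  set a := (univ.filter (fun i => P i = mkDiv 1)).card with ha
  set b := (univ.filter (fun i => P i = mkDiv 0)).card with hb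
  have hab : (a : ℝ) + b = n := by exact_mod_cast hcard
  have hb0 : (0 : ℝ) ≤ b := by positivity
  have hM : MU n (fun i => P i 0) = (a : ℝ) / n := by
    have hna : (n : ℝ) * ((a : ℝ) / n) = a := by field_simp
    apply MU_eq hn
    · rw [hna, ha]
      norm_cast
      apply Finset.card_le_card
      intro i hi
      simp only [Finset.mem_filter, Finset.mem_univ, true_and] at hi ⊢
      rw [hi, ← ha]
      simp only [mkDiv, Matrix.cons_val_zero]
      rw [div_le_one hn0]; linarith
    · rw [hna]
      refine Nat.cast_le.2 (Finset.card_le_card ?_)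
      intro i hi
      simp only [Finset.mem_filter, Finset.mem_univ, true_and] at hi ⊢
      rcases hc i with h | h
      · exact h
      · exfalso
        rw [h] at hi
        simp only [mkDiv, Matrix.cons_val_zero] at hi
        exact absurd hi (not_lt.2 (by positivity))
  intro j
  rw [Nat.card_eq_fintype_card, Fintype.card_subtype]
  fin_cases j
  · simp only [Fin.zero_eta, unit_zero]
    rw [AUnif_zero, hM]
  · simp only [Fin.mk_one, unit_one]
    rw [AUnif_one, hM, ← hb, eq_div_iff hn0.ne']
    field_simp
    linarith

section Uniq
variable {n : ℕ} {A : (Fin n → Fin 2 → ℝ) → Fin 2 → ℝ}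

/-- One-dimensional form of a mechanism. -/
def gA (A : (Fin n → Fin 2 → ℝ) → Fin 2 → ℝ) (v : Fin n → ℝ) : ℝ := A (fun i => mkDiv (v i)) 0

theorem upd_mk (v : Fin n → ℝ) (i : Fin n) (t : ℝ) :
    (fun j => mkDiv (Function.update v i t j)) =
      Function.update (fun j => mkDiv (v j)) i (mkDiv t) := by
  ext j k
  by_cases h : j = i
  · subst h; simp
  · simp [Function.update_of_ne h]

theorem upd_mem {v : Fin n → ℝ} (hv : ∀ i, v i ∈ Set.Icc (0 : ℝ) 1) (i : Fin n) {t : ℝ}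
    (ht : t ∈ Set.Icc (0 : ℝ) 1) : ∀ j, Function.update v i t j ∈ Set.Icc (0 : ℝ) 1 := by
  intro j
  by_cases h : j = i
  · subst h; simpa using ht
  · simpa [Function.update_of_ne h] using hv j

theorem gA_ic (hV : ValidMech A) (hI : IncentiveCompatible A) {v : Fin n → ℝ}
    (hv : ∀ i, v i ∈ Set.Icc (0 : ℝ) 1) (i : Fin n) {t s : ℝ}
    (ht : t ∈ Set.Icc (0 : ℝ) 1) (hs : s ∈ Set.Icc (0 : ℝ) 1) :
    |gA A (Function.update v i t) - t| ≤ |gA A (Function.update v i s) - t| := by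
  have h := hI (fun i => mkDiv (v i)) (fun i => mkDiv_isDiv (hv i)) i _ _
    (mkDiv_isDiv ht) (mkDiv_isDiv hs)
  have key : ∀ r ∈ Set.Icc (0 : ℝ) 1,
      l1 (A (Function.update (fun i => mkDiv (v i)) i (mkDiv r))) (mkDiv t) =
        2 * |gA A (Function.update v i r) - t| := by
    intro r hr
    rw [← upd_mk]
    rw [l1_two _ _ (division_snd (hV _ fun j => mkDiv_isDiv (upd_mem hv i hr j)))
      (division_snd (mkDiv_isDiv ht))]
    rfl
  rw [key t ht, key s hs] at h
  linarith

theorem gA_mem (hV : ValidMech A) {v : Fin n → ℝ}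
    (hv : ∀ i, v i ∈ Set.Icc (0 : ℝ) 1) : gA A v ∈ Set.Icc (0 : ℝ) 1 :=
  (hV _ fun j => mkDiv_isDiv (hv j)).1 0

theorem gA_cont (hC : ContinuousOn A {P | IsProfile P}) {v : Fin n → ℝ}
    (hv : ∀ i, v i ∈ Set.Icc (0 : ℝ) 1) (i : Fin n) :
    ContinuousOn (fun t => gA A (Function.update v i t)) (Set.Icc 0 1) := by
  have h1 : Continuous (fun t : ℝ => (fun j => mkDiv (Function.update v i t j))) := by
    refine continuous_pi fun j => ?_
    have : Continuous mkDiv := by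
      refine continuous_pi fun k => ?_
      fin_cases k
      · simp [mkDiv]; exact continuous_id
      · simp [mkDiv]; fun_prop
    have h2 : Continuous (fun t : ℝ => Function.update v i t) :=
      continuous_const.update i continuous_id
    exact this.comp ((continuous_apply j).comp h2)
  have h2 := hC.comp h1.continuousOn (s := Set.Icc 0 1)
    (fun t ht => fun j => mkDiv_isDiv (upd_mem hv i ht j))
  exact (continuous_apply (0 : Fin 2)).comp_continuousOn h2

theorem up_step (hV : ValidMech A) (hI : IncentiveCompatible A) {v : Fin n → ℝ}
    (hv : ∀ i, v i ∈ Set.Icc (0 : ℝ) 1) (i : Fin n) :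
    gA A v ≤ gA A (Function.update v i 1) := by
  have h1 : (1 : ℝ) ∈ Set.Icc (0 : ℝ) 1 := by simp
  have := gA_ic hV hI hv i h1 (hv i)
  rw [Function.update_eq_self, abs_of_nonpos, abs_of_nonpos] at this
  · linarith
  · linarith [(gA_mem hV hv).2]
  · linarith [(gA_mem hV (upd_mem hv i h1)).2]

theorem down_step (hV : ValidMech A) (hI : IncentiveCompatible A) {v : Fin n → ℝ}
    (hv : ∀ i, v i ∈ Set.Icc (0 : ℝ) 1) (i : Fin n) :
    gA A (Function.update v i 0) ≤ gA A v := by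
  have h1 : (0 : ℝ) ∈ Set.Icc (0 : ℝ) 1 := by simp
  have := gA_ic hV hI hv i h1 (hv i)
  rw [Function.update_eq_self, abs_of_nonneg, abs_of_nonneg] at this
  · linarith
  · linarith [(gA_mem hV hv).1]
  · linarith [(gA_mem hV (upd_mem hv i h1)).1]

theorem stay_down (hV : ValidMech A) (hC : ContinuousOn A {P | IsProfile P})
    (hI : IncentiveCompatible A) {v : Fin n → ℝ}
    (hv : ∀ i, v i ∈ Set.Icc (0 : ℝ) 1) (i : Fin n) (hi : v i < gA A v) :
    gA A (Function.update v i 0) = gA A v := by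
  have h0 : (0 : ℝ) ∈ Set.Icc (0 : ℝ) 1 := by simp
  have hd := down_step hV hI hv i
  by_contra hne
  have hlt := lt_of_le_of_ne hd hne
  have hic := gA_ic hV hI hv i (hv i) h0
  rw [Function.update_eq_self, abs_of_pos (by linarith)] at hic
  have hz : gA A (Function.update v i 0) ≤ v i := by
    by_contra hh
    push Not at hh
    rw [abs_of_pos (by linarith)] at hic
    linarith
  have hivt := intermediate_value_Icc (hv i).1
    ((gA_cont hC hv i).mono (Set.Icc_subset_Icc le_rfl (hv i).2))
  have hm : v i ∈ Set.Icc (gA A (Function.update v i 0)) (gA A (Function.update v i (v i))) := by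
    rw [Function.update_eq_self]; exact ⟨hz, hi.le⟩
  obtain ⟨s, hs, hs'⟩ := hivt hm
  have := gA_ic hV hI hv i (hv i) (s := s) ⟨hs.1, hs.2.trans (hv i).2⟩
  simp only at hs'
  rw [hs', Function.update_eq_self, abs_of_pos (by linarith)] at this
  simp at this
  linarith

theorem stay_up (hV : ValidMech A) (hC : ContinuousOn A {P | IsProfile P})
    (hI : IncentiveCompatible A) {v : Fin n → ℝ}
    (hv : ∀ i, v i ∈ Set.Icc (0 : ℝ) 1) (i : Fin n) (hi : gA A v < v i) :
    gA A (Function.update v i 1) = gA A v := by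
  have h0 : (1 : ℝ) ∈ Set.Icc (0 : ℝ) 1 := by simp
  have hd := up_step hV hI hv i
  by_contra hne
  have hlt := lt_of_le_of_ne hd (Ne.symm hne)
  have hic := gA_ic hV hI hv i (hv i) h0
  rw [Function.update_eq_self, abs_of_neg (by linarith)] at hic
  have hz : v i ≤ gA A (Function.update v i 1) := by
    by_contra hh
    push Not at hh
    rw [abs_of_neg (by linarith)] at hic
    linarith
  have hivt := intermediate_value_Icc (hv i).2
    ((gA_cont hC hv i).mono (Set.Icc_subset_Icc (hv i).1 le_rfl))
  have hm : v i ∈ Set.Icc (gA A (Function.update v i (v i))) (gA A (Function.update v i 1)) := by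
    rw [Function.update_eq_self]; exact ⟨hi.le, hz⟩
  obtain ⟨s, hs, hs'⟩ := hivt hm
  have := gA_ic hV hI hv i (hv i) (s := s) ⟨(hv i).1.trans hs.1, hs.2⟩
  simp only at hs'
  rw [hs', Function.update_eq_self, abs_of_neg (by linarith)] at this
  simp at this
  linarith

theorem pw_mem {v w : Fin n → ℝ} (hv : ∀ i, v i ∈ Set.Icc (0 : ℝ) 1)
    (hw : ∀ i, w i ∈ Set.Icc (0 : ℝ) 1) (S : Finset (Fin n)) :
    ∀ i, S.piecewise w v i ∈ Set.Icc (0 : ℝ) 1 := by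
  intro i
  by_cases h : i ∈ S
  · rw [Finset.piecewise_eq_of_mem _ _ _ h]; exact hw i
  · rw [Finset.piecewise_eq_of_notMem _ _ _ h]; exact hv i

theorem zero_mem' (i : Fin n) : (fun _ : Fin n => (0 : ℝ)) i ∈ Set.Icc (0 : ℝ) 1 := by simp

theorem one_mem' (i : Fin n) : (fun _ : Fin n => (1 : ℝ)) i ∈ Set.Icc (0 : ℝ) 1 := by simp

theorem up_S (hV : ValidMech A) (hI : IncentiveCompatible A) {v : Fin n → ℝ}
    (hv : ∀ i, v i ∈ Set.Icc (0 : ℝ) 1) (S : Finset (Fin n)) :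
    gA A v ≤ gA A (S.piecewise (fun _ => 1) v) := by
  induction S using Finset.induction_on with
  | empty => simp
  | insert j S hj ih =>
    rw [Finset.piecewise_insert]
    exact ih.trans (up_step hV hI (pw_mem hv one_mem' S) j)

theorem down_S (hV : ValidMech A) (hI : IncentiveCompatible A) {v : Fin n → ℝ}
    (hv : ∀ i, v i ∈ Set.Icc (0 : ℝ) 1) (S : Finset (Fin n)) :
    gA A (S.piecewise (fun _ => 0) v) ≤ gA A v := by
  induction S using Finset.induction_on with
  | empty => simp
  | insert j S hj ih =>
    rw [Finset.piecewise_insert]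
    exact (down_step hV hI (pw_mem hv zero_mem' S) j).trans ih

theorem stay_up_S (hV : ValidMech A) (hC : ContinuousOn A {P | IsProfile P})
    (hI : IncentiveCompatible A) {v : Fin n → ℝ}
    (hv : ∀ i, v i ∈ Set.Icc (0 : ℝ) 1) (S : Finset (Fin n)) (hS : ∀ i ∈ S, gA A v < v i) :
    gA A (S.piecewise (fun _ => 1) v) = gA A v := by
  induction S using Finset.induction_on with
  | empty => simp
  | insert j S hj ih =>
    have ih' := ih (fun i hi => hS i (Finset.mem_insert_of_mem hi))
    rw [Finset.piecewise_insert, stay_up hV hC hI (pw_mem hv one_mem' S) j, ih']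
    rw [ih', Finset.piecewise_eq_of_notMem _ _ _ hj]
    exact hS j (Finset.mem_insert_self _ _)

theorem stay_down_S (hV : ValidMech A) (hC : ContinuousOn A {P | IsProfile P})
    (hI : IncentiveCompatible A) {v : Fin n → ℝ}
    (hv : ∀ i, v i ∈ Set.Icc (0 : ℝ) 1) (S : Finset (Fin n)) (hS : ∀ i ∈ S, v i < gA A v) :
    gA A (S.piecewise (fun _ => 0) v) = gA A v := by
  induction S using Finset.induction_on with
  | empty => simp
  | insert j S hj ih =>
    have ih' := ih (fun i hi => hS i (Finset.mem_insert_of_mem hi))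
    rw [Finset.piecewise_insert, stay_down hV hC hI (pw_mem hv zero_mem' S) j, ih']
    rw [ih', Finset.piecewise_eq_of_notMem _ _ _ hj]
    exact hS j (Finset.mem_insert_self _ _)

theorem gA_prop (hP : Proportional A) (S : Finset (Fin n)) :
    gA A (S.piecewise (fun _ => 1) (fun _ => 0)) = (S.card : ℝ) / n := by
  unfold gA
  rw [hP]
  · congr 2
    rw [Nat.card_eq_fintype_card, Fintype.card_subtype]
    congr 1
    ext i
    simp only [Finset.mem_filter, Finset.mem_univ, true_and, unit_zero]
    by_cases h : i ∈ S
    · simp [h]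
    · simp only [h, iff_false, Finset.piecewise_eq_of_notMem _ _ _ h]
      intro h; have := congrFun h 0; simp [mkDiv] at this
  · intro i
    by_cases h : i ∈ S
    · exact ⟨0, by simp [h, unit_zero]⟩
    · exact ⟨1, by simp [h, unit_one]⟩

theorem gA_eq (hn : 1 ≤ n) (hV : ValidMech A) (hC : ContinuousOn A {P | IsProfile P})
    (hI : IncentiveCompatible A) (hP : Proportional A) {v : Fin n → ℝ}
    (hv : ∀ i, v i ∈ Set.Icc (0 : ℝ) 1) : MU n v = gA A v := by
  have hn0 : (0 : ℝ) < n := by exact_mod_cast hn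
  apply MU_eq hn
  · have h1 := stay_down_S hV hC hI hv (univ.filter fun i => v i < gA A v) (by simp)
    have h2 := up_S hV hI (pw_mem hv zero_mem' (univ.filter fun i => v i < gA A v))
      (univ.filter fun i => gA A v ≤ v i)
    rw [h1] at h2
    have h3 := gA_prop hP (univ.filter fun i => gA A v ≤ v i)
    have e : (univ.filter fun i => gA A v ≤ v i).piecewise (fun _ => (1 : ℝ))
        ((univ.filter fun i => v i < gA A v).piecewise (fun _ => 0) v) =
        (univ.filter fun i => gA A v ≤ v i).piecewise (fun _ => 1) (fun _ => 0) := by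
      ext i
      simp only [Finset.piecewise, Finset.mem_filter, Finset.mem_univ, true_and]
      split_ifs <;> first | rfl | (exfalso; linarith)
    rw [e, h3, le_div_iff₀ hn0] at h2
    linarith
  · have h1 := stay_up_S hV hC hI hv (univ.filter fun i => gA A v < v i) (by simp)
    have h2 := down_S hV hI (pw_mem hv one_mem' (univ.filter fun i => gA A v < v i))
      (univ.filter fun i => v i ≤ gA A v)
    rw [h1] at h2
    have h3 := gA_prop hP (univ.filter fun i => gA A v < v i)
    have e : (univ.filter fun i => v i ≤ gA A v).piecewise (fun _ => (0 : ℝ))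
        ((univ.filter fun i => gA A v < v i).piecewise (fun _ => 1) v) =
        (univ.filter fun i => gA A v < v i).piecewise (fun _ => 1) (fun _ => 0) := by
      ext i
      simp only [Finset.piecewise, Finset.mem_filter, Finset.mem_univ, true_and]
      split_ifs <;> first | rfl | (exfalso; linarith)
    rw [e, h3, div_le_iff₀ hn0] at h2
    linarith

end Uniq

/-- the uniform phantom mechanism is anonymous, continuous, incentive
compatible and proportional, and it is the unique such mechanism for `m = 2`. -/
theorem uniform_phantom_unique (n : ℕ) (hn : 1 ≤ n) :
    (Anonymous (AUnif n) ∧ ContinuousOn (AUnif n) {P | IsProfile P} ∧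
      IncentiveCompatible (AUnif n) ∧ Proportional (AUnif n)) ∧
    ∀ A : (Fin n → Fin 2 → ℝ) → Fin 2 → ℝ, ValidMech A → Anonymous A →
      ContinuousOn A {P | IsProfile P} → IncentiveCompatible A → Proportional A →
      ∀ P : Fin n → Fin 2 → ℝ, IsProfile P → A P = AUnif n P := by
  refine ⟨⟨?_, ?_, ?_, AUnif_prop hn⟩, ?_⟩
  · intro P _ σ
    have h := MU_perm hn (fun i => P i 0) σ
    have h' : MU n (fun i => (P ∘ σ) i 0) = MU n (fun i => P i 0) := h
    ext j
    fin_cases j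
    · simp only [Fin.zero_eta]
      rw [AUnif_zero, AUnif_zero, h']
    · simp only [Fin.mk_one]
      rw [AUnif_one, AUnif_one, h']
  · apply Continuous.continuousOn
    have h : Continuous (fun P : Fin n → Fin 2 → ℝ => MU n (fun i => P i 0)) :=
      (MU_lip hn).continuous.comp (by fun_prop)
    refine continuous_pi fun j => ?_
    fin_cases j
    · simpa only [Fin.zero_eta, AUnif_zero] using h
    · simp only [Fin.mk_one, AUnif_one]
      exact continuous_const.sub h
  · intro P _ i pt pm ht hm
    have key : ∀ p : Fin 2 → ℝ, l1 (AUnif n (Function.update P i p)) pt =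
        2 * |MU n (Function.update (fun i => P i 0) i (p 0)) - pt 0| := by
      intro p
      rw [l1_two _ _ (by rw [AUnif_one, AUnif_zero]) (division_snd ht), AUnif_zero]
      congr 4
      ext j
      by_cases h : j = i
      · subst h; simp
      · simp [Function.update_of_ne h]
    rw [key, key]
    linarith [MU_ic hn (fun i => P i 0) i (pt 0) (pm 0)]
  · intro A hV _ hC hI hP P hprof
    have h := gA_eq hn hV hC hI hP (v := fun i => P i 0) (fun i => (hprof i).1 0)
    have e : (fun i => mkDiv (P i 0)) = P := by
      ext i; rw [mkDiv_eq (hprof i)]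
    unfold gA at h
    simp only [e] at h
    ext j
    fin_cases j
    · simp only [Fin.zero_eta]
      rw [AUnif_zero, h]
    · simp only [Fin.mk_one]
      rw [AUnif_one, h, division_snd (hV P hprof)]
end

section
/- Every moving phantom mechanism is incentive compatible: for every phantom system F, every preference profile P, every voter i, and all budget divisions p_i and p̂_i, d(A^F(P_{-i}, p̂_i), p_i) ≥ d(A^F(P_{-i}, p_i), p_i). -/
open Finset

lemma sorted_get_iff (q : ℝ → Bool) (hq : ∀ a b, a ≤ b → q b = true → q a = true) :
    ∀ (s : List ℝ), s.Pairwise (· ≤ ·) → ∀ k, k < s.length →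
      (q (s.getD k 0) = true ↔ k < s.countP q) := by
  intro s
  induction s with
  | nil => intro _ k hk; simp at hk
  | cons a s ih =>
    intro hs k hk
    rw [List.pairwise_cons] at hs
    obtain ⟨h1, h2⟩ := hs
    by_cases ha : q a = true
    · rw [List.countP_cons_of_pos ha]
      cases k with
      | zero => simp [ha]
      | succ k =>
        have := ih h2 k (by simpa using hk)
        rw [List.getD_cons_succ, this]
        omega
    · have hz : ∀ b ∈ s, ¬ q b = true := fun b hb h => ha (hq a b (h1 b hb) h)
      have h0 : s.countP q = 0 := List.countP_eq_zero.2 hz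
      rw [List.countP_cons_of_neg ha, h0]
      cases k with
      | zero => simp [ha]
      | succ k =>
        have hk' : k < s.length := by simpa using hk
        have := ih h2 k hk'
        rw [List.getD_cons_succ, this, h0]
        omega

lemma medList_iff (q : ℝ → Bool) (hq : ∀ a b, a ≤ b → q b = true → q a = true)
    (l : List ℝ) (hl : 0 < l.length) :
    q (medList l) = true ↔ (l.length - 1) / 2 < l.countP q := by
  unfold medList
  have hp : ((Multiset.ofList l).sort (· ≤ ·)).Perm l :=
    Multiset.coe_eq_coe.1 (Multiset.sort_eq _ _)
  rw [sorted_get_iff q hq _ (Multiset.pairwise_sort _ _) _ (by rw [hp.length_eq]; omega),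
    hp.countP_eq]

lemma phMed_iff {n m : ℕ} (f : Fin (n + 1) → ℝ → ℝ) (P : Fin n → Fin m → ℝ) (t : ℝ) (j : Fin m)
    (q : ℝ → Bool) (hq : ∀ a b, a ≤ b → q b = true → q a = true) :
    q (phMed f P t j) = true ↔
      n < (List.finRange (n + 1)).countP (fun k => q (f k t)) +
        (List.finRange n).countP (fun i => q (P i j)) := by
  unfold phMed
  rw [medList_iff q hq _ (by simp), List.countP_append, List.ofFn_eq_map, List.ofFn_eq_map,
    List.countP_map, List.countP_map]
  have : (List.map (fun k => f k t) (List.finRange (n+1)) ++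
    List.map (fun i => P i j) (List.finRange n)).length = 2 * n + 1 := by simp; omega
  rw [this, show (2 * n + 1 - 1) / 2 = n by omega]
  rfl

lemma phMed_le_iff {n m : ℕ} (f : Fin (n + 1) → ℝ → ℝ) (P : Fin n → Fin m → ℝ) (t : ℝ)
    (j : Fin m) (c : ℝ) :
    phMed f P t j ≤ c ↔
      n < (List.finRange (n + 1)).countP (fun k => decide (f k t ≤ c)) +
        (List.finRange n).countP (fun i => decide (P i j ≤ c)) := by
  have := phMed_iff f P t j (fun x => decide (x ≤ c))
    (by intro a b h; simpa using fun h' => h.trans h')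
  simpa using this

lemma phMed_lt_iff {n m : ℕ} (f : Fin (n + 1) → ℝ → ℝ) (P : Fin n → Fin m → ℝ) (t : ℝ)
    (j : Fin m) (c : ℝ) :
    phMed f P t j < c ↔
      n < (List.finRange (n + 1)).countP (fun k => decide (f k t < c)) +
        (List.finRange n).countP (fun i => decide (P i j < c)) := by
  have := phMed_iff f P t j (fun x => decide (x < c))
    (by intro a b h; simpa using fun h' => h.trans_lt h')
  simpa using this

lemma phMed_le_add {n m : ℕ} (f : Fin (n + 1) → ℝ → ℝ) (P : Fin n → Fin m → ℝ) (t t' : ℝ)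
    (j : Fin m) (e : ℝ) (he : 0 ≤ e) (h : ∀ k, f k t ≤ f k t' + e) :
    phMed f P t j ≤ phMed f P t' j + e := by
  rw [phMed_le_iff]
  have h1 := (phMed_le_iff f P t' j _).1 le_rfl
  refine h1.trans_le (add_le_add (List.countP_mono_left ?_) (List.countP_mono_left ?_))
  · intro k _ hk
    simp only [decide_eq_true_eq] at hk ⊢
    linarith [h k]
  · intro k _ hk
    simp only [decide_eq_true_eq] at hk ⊢
    linarith

lemma phMed_between_lo {n m : ℕ} (f : Fin (n + 1) → ℝ → ℝ) (P : Fin n → Fin m → ℝ) (t : ℝ)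
    (j : Fin m) (i : Fin n) (p q : Fin m → ℝ)
    (h : p j < phMed f (Function.update P i p) t j) :
    phMed f (Function.update P i p) t j ≤ phMed f (Function.update P i q) t j := by
  by_contra! hc
  rw [phMed_lt_iff] at hc
  refine lt_irrefl (phMed f (Function.update P i p) t j) ((phMed_lt_iff _ _ _ _ _).2 ?_)
  refine hc.trans_le (add_le_add le_rfl (List.countP_mono_left ?_))
  intro k _ hk
  simp only [decide_eq_true_eq] at hk ⊢
  by_cases hki : k = i
  · subst hki; rw [Function.update_self]; exact h
  · rw [Function.update_of_ne hki] at hk; rwa [Function.update_of_ne hki (f := P)]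

lemma phMed_between_hi {n m : ℕ} (f : Fin (n + 1) → ℝ → ℝ) (P : Fin n → Fin m → ℝ) (t : ℝ)
    (j : Fin m) (i : Fin n) (p q : Fin m → ℝ)
    (h : phMed f (Function.update P i p) t j < p j) :
    phMed f (Function.update P i q) t j ≤ phMed f (Function.update P i p) t j := by
  rw [phMed_le_iff]
  have h1 := (phMed_le_iff f (Function.update P i p) t j _).1 le_rfl
  refine h1.trans_le (add_le_add le_rfl (List.countP_mono_left ?_))
  intro k _ hk
  simp only [decide_eq_true_eq] at hk ⊢
  by_cases hki : k = i
  · subst hki; rw [Function.update_self] at hk; exact absurd h (not_lt.2 hk)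
  · rw [Function.update_of_ne hki (f := P)] at hk; rwa [Function.update_of_ne hki]

lemma phMed_cont {n m : ℕ} (f : Fin (n + 1) → ℝ → ℝ) (hf : IsPhantomSystem n f)
    (P : Fin n → Fin m → ℝ) (j : Fin m) :
    ContinuousOn (fun t => phMed f P t j) (Set.Icc 0 1) := by
  intro t ht
  rw [ContinuousWithinAt, Metric.tendsto_nhds]
  intro e he
  have h1 : ∀ k, ∀ᶠ s in nhdsWithin t (Set.Icc 0 1), dist (f k s) (f k t) < e / 2 :=
    fun k => Metric.tendsto_nhds.1 (hf.cont k t ht) (e / 2) (by positivity)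
  filter_upwards [Filter.eventually_all.2 h1] with s hs
  have h2 := phMed_le_add f P s t j (e / 2) (by positivity)
    (fun k => by have := abs_lt.1 (hs k); linarith)
  have h3 := phMed_le_add f P t s j (e / 2) (by positivity)
    (fun k => by have := abs_lt.1 (hs k); linarith)
  rw [Real.dist_eq, abs_lt]
  constructor <;> linarith

lemma tStar_mem {n m : ℕ} (hm : 2 ≤ m) (f : Fin (n + 1) → ℝ → ℝ) (hf : IsPhantomSystem n f)
    (P : Fin n → Fin m → ℝ) (hP : IsProfile P) :
    tStar f P ∈ Set.Icc (0 : ℝ) 1 ∧ ∑ j, phMed f P (tStar f P) j = 1 := by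
  have hc : ContinuousOn (fun t => ∑ j, phMed f P t j) (Set.Icc 0 1) :=
    continuousOn_finsetSum _ fun j _ => phMed_cont f hf P j
  have h0 : ∑ j, phMed f P 0 j ≤ 0 := by
    refine Finset.sum_nonpos fun j _ => ?_
    rw [phMed_le_iff]
    simp [hf.apply_zero]
    omega
  have h1 : (1 : ℝ) ≤ ∑ j, phMed f P 1 j := by
    have h : ∀ j ∈ (Finset.univ : Finset (Fin m)), (1 : ℝ) ≤ phMed f P 1 j := by
      intro j _
      rw [← not_lt, phMed_lt_iff]
      simp only [hf.apply_one, lt_irrefl]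
      have := List.countP_le_length (l := List.finRange n) (p := fun i => decide (P i j < 1))
      simp at this ⊢
      exact this
    have h2 := Finset.card_nsmul_le_sum _ _ _ h
    simp at h2
    have h3 : (2 : ℝ) ≤ m := by exact_mod_cast hm
    linarith
  have hcl : IsClosed (Set.Icc (0:ℝ) 1 ∩ (fun t => ∑ j, phMed f P t j) ⁻¹' {1}) :=
    hc.preimage_isClosed_of_isClosed isClosed_Icc isClosed_singleton
  obtain ⟨t, ht, ht1⟩ := intermediate_value_Icc (zero_le_one (α := ℝ)) hc
    (show (1 : ℝ) ∈ Set.Icc _ _ from ⟨by linarith, h1⟩)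
  exact hcl.csInf_mem ⟨t, ht, ht1⟩ ⟨0, fun s hs => hs.1.1⟩

lemma phMed_mono {n m : ℕ} (f : Fin (n + 1) → ℝ → ℝ) (hf : IsPhantomSystem n f)
    (P : Fin n → Fin m → ℝ) (j : Fin m) {s t : ℝ} (hs : s ∈ Set.Icc (0:ℝ) 1)
    (ht : t ∈ Set.Icc (0:ℝ) 1) (h : s ≤ t) : phMed f P s j ≤ phMed f P t j := by
  have := phMed_le_add f P s t j 0 le_rfl (fun k => by simpa using hf.mono k hs ht h)
  simpa using this

/-- every moving phantom mechanism is incentive compatible. -/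
theorem moving_phantom_ic (n m : ℕ) (hn : 1 ≤ n) (hm : 2 ≤ m)
    (f : Fin (n + 1) → ℝ → ℝ) (hf : IsPhantomSystem n f) :
    IncentiveCompatible (fun P : Fin n → Fin m → ℝ => AMP f P) := by
  intro P hP i p q hp hq
  have hup : ∀ r, IsDivision r → IsProfile (Function.update P i r) := by
    intro r hr k
    by_cases hk : k = i
    · subst hk; rw [Function.update_self]; exact hr
    · rw [Function.update_of_ne hk]; exact hP k
  obtain ⟨ht, hx⟩ := tStar_mem hm f hf _ (hup p hp)
  obtain ⟨ht', hy⟩ := tStar_mem hm f hf _ (hup q hq)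
  show ∑ j, |phMed f (Function.update P i p) (tStar f (Function.update P i p)) j - p j| ≤
    ∑ j, |phMed f (Function.update P i q) (tStar f (Function.update P i q)) j - p j|
  generalize tStar f (Function.update P i p) = t at *
  generalize tStar f (Function.update P i q) = t' at *
  have key : ∀ j, |phMed f (Function.update P i p) t j - p j|
      + |phMed f (Function.update P i q) t j - phMed f (Function.update P i p) t j|
      ≤ |phMed f (Function.update P i q) t j - p j| := by
    intro j
    have h1 := phMed_between_lo f P t j i p q
    have h2 := phMed_between_hi f P t j i p q
    generalize phMed f (Function.update P i p) t j = x at *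
    generalize phMed f (Function.update P i q) t j = z at *
    rcases lt_trichotomy (p j) x with h | h | h
    · have := h1 h
      rw [abs_of_nonneg, abs_of_nonneg, abs_of_nonneg] <;> linarith
    · simp [h]
    · have := h2 h
      rw [abs_of_nonpos, abs_of_nonpos, abs_of_nonpos] <;> linarith
  rcases le_total t t' with h | h
  · have hz : ∀ j, |phMed f (Function.update P i p) t j - p j| +
        (phMed f (Function.update P i p) t j - phMed f (Function.update P i q) t' j) ≤
        |phMed f (Function.update P i q) t' j - p j| := by
      intro j
      have hm := phMed_mono f hf (Function.update P i q) j ht ht' h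
      have k1 := key j
      have k2 := neg_abs_le
        (phMed f (Function.update P i q) t j - phMed f (Function.update P i p) t j)
      have k3 := abs_sub_abs_le_abs_sub (phMed f (Function.update P i q) t j - p j)
        (phMed f (Function.update P i q) t' j - p j)
      rw [sub_sub_sub_cancel_right, abs_of_nonpos (by linarith :
        phMed f (Function.update P i q) t j - phMed f (Function.update P i q) t' j ≤ 0)] at k3
      linarith
    have := Finset.sum_le_sum (s := Finset.univ) fun j _ => hz j
    rw [Finset.sum_add_distrib, Finset.sum_sub_distrib, hx, hy] at this
    linarith
  · have hz : ∀ j, |phMed f (Function.update P i p) t j - p j| +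
        (phMed f (Function.update P i q) t' j - phMed f (Function.update P i p) t j) ≤
        |phMed f (Function.update P i q) t' j - p j| := by
      intro j
      have hm := phMed_mono f hf (Function.update P i q) j ht' ht h
      have k1 := key j
      have k2 := le_abs_self
        (phMed f (Function.update P i q) t j - phMed f (Function.update P i p) t j)
      have k3 := abs_sub_abs_le_abs_sub (phMed f (Function.update P i q) t j - p j)
        (phMed f (Function.update P i q) t' j - p j)
      rw [sub_sub_sub_cancel_right, abs_of_nonneg (by linarith :
        0 ≤ phMed f (Function.update P i q) t j - phMed f (Function.update P i q) t' j)] at k3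
      linarith
    have := Finset.sum_le_sum (s := Finset.univ) fun j _ => hz j
    rw [Finset.sum_add_distrib, Finset.sum_sub_distrib, hx, hy] at this
    linarith
end
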